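/- arXiv:1603.06105 — 3 statements merged into one kernel-verified Lean document; each statement's English description precedes it below -/
import Mathlib

section
/- Let g be a Lie algebra over the complex numbers, n a Lie ideal of g, and v an element of the center z(n) of n. Then the linear map id + ad v is a Lie algebra automorphism of g, i.e. (id + ad v)([x, y]) = [(id + ad v)(x), (id + ad v)(y)] for all x, y ∈ g. -/
/-- For `v` in the center of a Lie ideal `n` of a complex Lie algebra `g`, the linear
map `id + ad v` is a Lie algebra automorphism of `g`. -/
theorem one_add_ad_lie_automorphism (g : Type*) [LieRing g] [LieAlgebra ℂ g]
    (n : LieIdeal ℂ g) (v : g) (hv : v ∈ n ∧ ∀ w ∈ n, ⁅v, w⁆ = 0) :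
    ∃ e : g ≃ₗ⁅ℂ⁆ g, ∀ x : g, e x = x + ⁅v, x⁆ := by
  obtain ⟨hvn, hcomm⟩ := hv
  have hmem (x : g) : ⁅v, x⁆ ∈ n := lie_mem_left ℂ g n v x hvn
  have hsq (x : g) : ⁅v, ⁅v, x⁆⁆ = 0 := hcomm _ (hmem x)
  have hbracket (x y : g) : ⁅⁅v, x⁆, ⁅v, y⁆⁆ = 0 := by
    rw [lie_lie, hsq, lie_zero, sub_zero]
    exact hcomm _ (lie_mem_right ℂ g n x _ (hmem y))
  refine ⟨{ toLinearMap := LinearMap.id + (LieAlgebra.ad ℂ g v : g →ₗ[ℂ] g)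
            map_lie' := fun {x y} => ?_
            invFun := fun x => x - ⁅v, x⁆
            left_inv := fun x => ?_
            right_inv := fun x => ?_ }, fun x => rfl⟩
  · change ⁅x, y⁆ + ⁅v, ⁅x, y⁆⁆ = ⁅x + ⁅v, x⁆, y + ⁅v, y⁆⁆
    rw [add_lie, lie_add, lie_add, hbracket, leibniz_lie v x y]
    abel
  · change x + ⁅v, x⁆ - ⁅v, x + ⁅v, x⁆⁆ = x
    simp [hsq]
  · change x - ⁅v, x⁆ + ⁅v, x - ⁅v, x⁆⁆ = x
    simp [hsq]
end

section
/- Let g be a finite-dimensional Lie algebra over the complex numbers and let x ∈ g be an element such that the adjoint endomorphism ad x is not nilpotent. Then the set of complex numbers λ for which there exists a Lie algebra automorphism σ of g with σ(x) = λ·x is finite. -/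
namespace Module.End

/-- Over an algebraically closed field, an endomorphism that is not nilpotent has a nonzero
eigenvalue. -/
theorem exists_hasEigenvalue_ne_zero_of_not_isNilpotent {K V : Type*} [Field K] [IsAlgClosed K]
    [AddCommGroup V] [Module K V] [FiniteDimensional K V] {f : End K V} (hf : ¬ IsNilpotent f) :
    ∃ μ ≠ 0, f.HasEigenvalue μ := by
  contrapose! hf
  have htop : f.maxGenEigenspace 0 = ⊤ := by
    rw [eq_top_iff, ← iSup_maxGenEigenspace_eq_top f]
    refine iSup_le fun μ ↦ ?_
    by_cases hμ : μ = 0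
    · rw [hμ]
    · have hbot : f.maxGenEigenspace μ = ⊥ := by
        by_contra h
        exact hf μ hμ (HasUnifEigenvalue.lt zero_lt_one h)
      rw [hbot]
      exact bot_le
  rw [maxGenEigenspace_eq_genEigenspace_finrank, genEigenspace_nat, zero_smul, sub_zero,
    LinearMap.ker_eq_top] at htop
  exact ⟨_, htop⟩

end Module.End

/-- If an automorphism sends `x` to `c • x` with `c ≠ 0`, it carries `μ`-eigenvectors of `ad x` to
`(μ / c)`-eigenvectors. -/
theorem LieEquiv.hasEigenvalue_ad_div {K L : Type*} [Field K] [LieRing L] [LieAlgebra K L]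
    (σ : L ≃ₗ⁅K⁆ L) {x : L} {c μ : K} (hc : c ≠ 0) (hσ : σ x = c • x)
    (hμ : Module.End.HasEigenvalue (LieAlgebra.ad K L x) μ) :
    Module.End.HasEigenvalue (LieAlgebra.ad K L x) (μ / c) := by
  obtain ⟨v, hv⟩ := hμ.exists_hasEigenvector
  have hscaled : c • ⁅x, σ v⁆ = μ • σ v := by
    have hxv : ⁅x, v⁆ = μ • v := hv.apply_eq_smul
    rw [← smul_lie, ← hσ, ← LieEquiv.map_lie, hxv, map_smul]
  refine Module.End.hasEigenvalue_of_hasEigenvector (x := σ v)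
    ⟨Module.End.mem_eigenspace_iff.mpr ?_, ?_⟩
  · rw [LieAlgebra.ad_apply, div_eq_inv_mul, mul_smul, ← hscaled, inv_smul_smul₀ hc]
  · exact fun h ↦ hv.2 (σ.injective (h.trans (map_zero σ).symm))

/-- If `x` is an element of a finite-dimensional complex Lie algebra `g` with `ad x`
not nilpotent, then the set of scalars `λ` such that some Lie algebra automorphism of
`g` sends `x` to `λ • x` is finite. -/
theorem finite_scalars_of_not_nilpotent (g : Type*) [LieRing g] [LieAlgebra ℂ g]
    [FiniteDimensional ℂ g] (x : g)
    (hx : ¬ IsNilpotent (LieAlgebra.ad ℂ g x)) :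
    {lam : ℂ | ∃ σ : g ≃ₗ⁅ℂ⁆ g, σ x = lam • x}.Finite := by
  obtain ⟨μ, hμ₀, hμ⟩ := Module.End.exists_hasEigenvalue_ne_zero_of_not_isNilpotent hx
  refine ((Module.End.finite_hasEigenvalue (LieAlgebra.ad ℂ g x)).image (μ / ·)).subset ?_
  rintro c ⟨σ, hσ⟩
  have hc : c ≠ 0 := by
    rintro rfl
    have hx₀ : x = 0 := σ.injective (hσ.trans ((zero_smul ℂ x).trans (map_zero σ).symm))
    exact hx (by simp [hx₀])
  exact ⟨μ / c, σ.hasEigenvalue_ad_div hc hσ hμ, div_div_cancel₀ hμ₀⟩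
end

section
/- Let g be a finite-dimensional Lie algebra over the complex numbers and let x ∈ g be an element such that for every nonzero complex number λ there exists a Lie algebra automorphism σ of g with σ(x) = λ·x. Then the adjoint endomorphism ad x is nilpotent. -/
/-- An endomorphism of a finite-dimensional vector space over an algebraically closed field is
nilpotent if `0` is its only possible eigenvalue. -/
theorem Module.End.isNilpotent_of_forall_hasEigenvalue_eq_zero {K V : Type*} [Field K]
    [IsAlgClosed K] [AddCommGroup V] [Module K V] [FiniteDimensional K V] (f : Module.End K V)
    (hf : ∀ c : K, f.HasEigenvalue c → c = 0) : IsNilpotent f := by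
  have hroots : f.charpoly.roots = Multiset.replicate f.charpoly.roots.card 0 := by
    refine Multiset.eq_replicate_card.2 fun c hc ↦ hf c ?_
    exact (Module.End.hasEigenvalue_iff_isRoot_charpoly f c).2 (Polynomial.isRoot_of_mem_roots hc)
  have hprod := (IsAlgClosed.splits f.charpoly).eq_prod_roots_of_monic f.charpoly_monic
  rw [hroots] at hprod
  refine ⟨f.charpoly.roots.card, ?_⟩
  have haeval := f.aeval_self_charpoly
  rw [hprod] at haeval
  simpa using haeval

/-- If every nonzero multiple of `x` is the image of `x` under an automorphism, then nonzero
eigenvalues of `ad x` can be rescaled by arbitrary nonzero scalars. -/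
theorem LieAlgebra.hasEigenvalue_ad_inv_mul {K L : Type*} [Field K] [LieRing L] [LieAlgebra K L]
    {x : L} {c a : K} (hc : c ≠ 0) (σ : L ≃ₗ⁅K⁆ L) (hσ : σ x = c • x)
    (ha : (LieAlgebra.ad K L x).HasEigenvalue a) :
    (LieAlgebra.ad K L x).HasEigenvalue (c⁻¹ * a) := by
  obtain ⟨v, hv⟩ := ha.exists_hasEigenvector
  have hxv : ⁅x, v⁆ = a • v := hv.apply_eq_smul
  refine Module.End.hasEigenvalue_of_hasEigenvector (x := σ v)
    (Module.End.hasEigenvector_iff.2 ⟨Module.End.mem_eigenspace_iff.2 ?_, ?_⟩)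
  · have hσv : c • ⁅x, σ v⁆ = a • σ v := by
      rw [← smul_lie, ← hσ, ← LieEquiv.map_lie, hxv, map_smul]
    rw [LieAlgebra.ad_apply, mul_smul, ← hσv, inv_smul_smul₀ hc]
  · exact fun h0 ↦ hv.2 (σ.injective (h0.trans (map_zero σ).symm))

/-- If every nonzero scalar multiple `λ • x` of an element `x` of a finite-dimensional
complex Lie algebra `g` is the image of `x` under some Lie algebra automorphism of `g`,
then `ad x` is nilpotent. -/
theorem ad_nilpotent_of_scalar_orbit (g : Type*) [LieRing g] [LieAlgebra ℂ g]
    [FiniteDimensional ℂ g] (x : g)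
    (h : ∀ lam : ℂ, lam ≠ 0 → ∃ σ : g ≃ₗ⁅ℂ⁆ g, σ x = lam • x) :
    IsNilpotent (LieAlgebra.ad ℂ g x) := by
  refine Module.End.isNilpotent_of_forall_hasEigenvalue_eq_zero _ fun a ha ↦ ?_
  by_contra ha0
  refine (Set.finite_singleton (0 : ℂ)).infinite_compl
    ((Module.End.finite_spectrum (LieAlgebra.ad ℂ g x)).subset fun b hb ↦ ?_)
  have hb0 : b ≠ 0 := hb
  have hc : a * b⁻¹ ≠ 0 := mul_ne_zero ha0 (inv_ne_zero hb0)
  obtain ⟨σ, hσ⟩ := h _ hc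
  have hev := LieAlgebra.hasEigenvalue_ad_inv_mul hc σ hσ ha
  have heq : (a * b⁻¹)⁻¹ * a = b := by field_simp
  rw [heq] at hev
  exact hev.mem_spectrum
end
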